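/- arXiv:2405.09207 — 9 statements merged into one kernel-verified Lean document; each statement's English description precedes it below -/
import Mathlib

section
/- Let n ≥ 1, 1 ≤ k ≤ n, let A ∈ ℝ^{n×n} with det A ≠ 0, let Σ ∈ ℝ^{n×n} be symmetric positive definite, and let W ∈ ℝ^{k×n} have full row rank (W Wᵀ invertible), with pseudoinverse W† = Wᵀ(W Wᵀ)⁻¹. Assume det(W A W†) ≠ 0. Then for every L > 0, the causal emergence satisfies Δ𝒥(W) = 𝒥(W A W†, W Σ Wᵀ, k) − 𝒥(A, Σ, n) = ln(|det(W A W†)|^{1/k} / |det A|^{1/n}) + ln((det Σ)^{1/(2n)} / (det(W Σ Wᵀ))^{1/(2k)}); in particular this value does not depend on L. -/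
open Matrix BigOperators

/-- Dimension-averaged effective information of a linear stochastic iteration
system with parameter-matrix determinant `dA`, noise-covariance determinant
`dSg`, state dimension `m`, and intervention scale `L`:
`𝒥 = (1/m) ln(|dA| Lᵐ / ((2πe)^{m/2} dSg^{1/2}))`. -/
noncomputable def Jinfo (m : ℕ) (dA dSg L : ℝ) : ℝ :=
  (1 / (m : ℝ)) *
    Real.log (|dA| * L ^ m /
      ((2 * Real.pi * Real.exp 1) ^ ((m : ℝ) / 2) * dSg ^ ((1 : ℝ) / 2)))

theorem vecMul_injective_of_isUnit_mul_transpose {m n R : Type*} [Fintype m] [DecidableEq m]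
    [Fintype n] [CommRing R] {W : Matrix m n R} (hW : IsUnit (W * Wᵀ)) :
    Function.Injective W.vecMul := by
  intro x y hxy
  apply Matrix.vecMul_injective_of_isUnit hW
  simpa only [← Matrix.vecMul_vecMul] using congrArg (fun v => Matrix.vecMul v Wᵀ) hxy

theorem Jinfo_eq {m : ℕ} (hm : m ≠ 0) {dA dSg L : ℝ} (hA : dA ≠ 0) (hSg : 0 < dSg) (hL : 0 < L) :
    Jinfo m dA dSg L = 1 / (m : ℝ) * Real.log |dA| - 1 / (2 * (m : ℝ)) * Real.log dSg +
      (Real.log L - Real.log (2 * Real.pi * Real.exp 1) / 2) := by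
  have hm' : (m : ℝ) ≠ 0 := Nat.cast_ne_zero.mpr hm
  have hA' : |dA| ≠ 0 := abs_ne_zero.mpr hA
  have hc : 0 < 2 * Real.pi * Real.exp 1 := by positivity
  rw [Jinfo, Real.log_div (by positivity) (by positivity), Real.log_mul hA' (by positivity),
    Real.log_mul (by positivity) (by positivity), Real.log_pow, Real.log_rpow hc,
    Real.log_rpow hSg]
  field_simp
  ring

/-- for a micro dynamics `x_{t+1} = A x_t + ε_t`, `ε_t ~ N(0, Σ)`,
and a full-row-rank coarse-graining `W` with pseudoinverse `W† = Wᵀ(WWᵀ)⁻¹`,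
the causal emergence `Δ𝒥 = 𝒥(WAW†, WΣWᵀ, k) − 𝒥(A, Σ, n)` equals
`ln(|det WAW†|^{1/k}/|det A|^{1/n}) + ln((det Σ)^{1/2n}/(det WΣWᵀ)^{1/2k})`
for every `L > 0`; in particular it does not depend on `L`. -/
theorem stmt0 {n k : ℕ} (hn : 1 ≤ n) (hk : 1 ≤ k) (hkn : k ≤ n)
    (A : Matrix (Fin n) (Fin n) ℝ) (hA : A.det ≠ 0)
    (Sg : Matrix (Fin n) (Fin n) ℝ) (hSg : Sg.PosDef)
    (W : Matrix (Fin k) (Fin n) ℝ) (hW : IsUnit (W * Wᵀ))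
    (Wdag : Matrix (Fin n) (Fin k) ℝ) (hWdag : Wdag = Wᵀ * (W * Wᵀ)⁻¹)
    (hAM : (W * A * Wdag).det ≠ 0) :
    ∀ L : ℝ, 0 < L →
      Jinfo k ((W * A * Wdag).det) ((W * Sg * Wᵀ).det) L - Jinfo n A.det Sg.det L =
        Real.log (|(W * A * Wdag).det| ^ ((1 : ℝ) / k) / |A.det| ^ ((1 : ℝ) / n)) +
        Real.log (Sg.det ^ (1 / (2 * (n : ℝ))) / (W * Sg * Wᵀ).det ^ (1 / (2 * (k : ℝ)))) := by
  intro L hL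
  have hS : 0 < Sg.det := hSg.det_pos
  have hM : 0 < (W * Sg * Wᵀ).det := by
    rw [← Matrix.conjTranspose_eq_transpose_of_trivial]
    exact (hSg.mul_mul_conjTranspose_same
      (vecMul_injective_of_isUnit_mul_transpose hW)).det_pos
  have hA' : 0 < |A.det| := abs_pos.mpr hA
  have hAM' : 0 < |(W * A * Wdag).det| := abs_pos.mpr hAM
  rw [Jinfo_eq (by omega) hAM hM hL, Jinfo_eq (by omega) hA hS hL,
    Real.log_div (by positivity) (by positivity), Real.log_div (by positivity) (by positivity),
    Real.log_rpow hAM', Real.log_rpow hA', Real.log_rpow hS, Real.log_rpow hM]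
  ring
end

section
/- Let A ∈ ℝ^{n×n} be symmetric with eigenvalues λ₁, …, λ_n (with multiplicity) ordered so that |λ₁| ≥ |λ₂| ≥ … ≥ |λ_n|, and let W ∈ ℝ^{k×n} (1 ≤ k ≤ n) have full row rank, with W† = Wᵀ(W Wᵀ)⁻¹. Then 0 ≤ |det(W A W†)| ≤ ∏_{i=1}^{k} |λ_i|. -/
open Matrix BigOperators

/-- Expansion of the determinant of `B * diagonal d * C` along the rows of `C`. -/
lemma det_mul_diagonal_mul_eq_sum {n k : ℕ} (B : Matrix (Fin k) (Fin n) ℝ) (d : Fin n → ℝ)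
    (C : Matrix (Fin n) (Fin k) ℝ) :
    (B * Matrix.diagonal d * C).det =
      ∑ f : Fin k → Fin n, (∏ i, d (f i)) * (∏ i, B i (f i)) * (C.submatrix f id).det := by
  have h : B * Matrix.diagonal d * C = fun i => ∑ j, (B i j * d j) • C j := by
    ext i l
    rw [Matrix.mul_apply]
    simp [Matrix.mul_diagonal, Finset.sum_apply]
  rw [h]
  change Matrix.detRowAlternating.toMultilinearMap _ = _
  rw [MultilinearMap.map_sum]
  refine Finset.sum_congr rfl fun f _ => ?_
  rw [MultilinearMap.map_smul_univ, Finset.prod_mul_distrib, smul_eq_mul, mul_comm (∏ i, d (f i))]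
  rfl

/-- A form of the Cauchy–Binet formula, summing over all functions rather than over subsets. -/
lemma factorial_mul_det_mul_diagonal_mul_transpose {n k : ℕ} (B : Matrix (Fin k) (Fin n) ℝ)
    (d : Fin n → ℝ) :
    (k.factorial : ℝ) * (B * Matrix.diagonal d * Bᵀ).det =
      ∑ f : Fin k → Fin n, (∏ i, d (f i)) * (Bᵀ.submatrix f id).det ^ 2 := by
  have key (σ : Equiv.Perm (Fin k)) : (B * Matrix.diagonal d * Bᵀ).det =
      ∑ f : Fin k → Fin n, (∏ i, d (f i)) *
        ((Equiv.Perm.sign σ : ℤ) * ∏ i, B i (f (σ i))) * (Bᵀ.submatrix f id).det := by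
    rw [det_mul_diagonal_mul_eq_sum, ← Equiv.sum_comp (σ.symm.arrowCongr (Equiv.refl (Fin n)))]
    refine Finset.sum_congr rfl fun f _ => ?_
    have h1 : Bᵀ.submatrix (f ∘ σ) id = (Bᵀ.submatrix f id).submatrix σ id := rfl
    have h2 : (σ.symm.arrowCongr (Equiv.refl (Fin n))) f = f ∘ σ := rfl
    rw [h2, h1, Matrix.det_permute]
    simp only [Function.comp_apply]
    rw [Equiv.prod_comp σ (fun i => d (f i))]
    ring
  have hcard : (k.factorial : ℝ) * (B * Matrix.diagonal d * Bᵀ).det =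
      ∑ _σ : Equiv.Perm (Fin k), (B * Matrix.diagonal d * Bᵀ).det := by
    simp [Fintype.card_perm]
  rw [hcard, Finset.sum_congr rfl fun σ _ => key σ, Finset.sum_comm]
  refine Finset.sum_congr rfl fun f _ => ?_
  rw [← Finset.sum_mul, ← Finset.mul_sum, sq, ← mul_assoc]
  congr 2
  rw [Matrix.det_apply']
  rfl

/-- The first `k` values of a nonnegative antitone family have the largest product. -/
lemma prod_comp_le_prod_filter_lt {n k : ℕ} (hkn : k ≤ n) {g : Fin n → ℝ} (hg : Antitone g)
    (hg0 : ∀ i, 0 ≤ g i) {f : Fin k → Fin n} (hf : Function.Injective f) :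
    ∏ i, g (f i) ≤ ∏ i ∈ Finset.univ.filter (fun i : Fin n => (i : ℕ) < k), g i := by
  set t := Finset.univ.filter (fun i : Fin n => (i : ℕ) < k) with ht
  set s := Finset.univ.image f with hs
  have hprod : ∏ i, g (f i) = ∏ j ∈ s, g j := by
    rw [hs, Finset.prod_image fun _ _ _ _ h => hf h]
  have hcs : s.card = k := by simp [hs, Finset.card_image_of_injective _ hf]
  have hct : t.card = k := by
    rw [ht, Fin.card_filter_val_lt, min_eq_right hkn]
  have hcard : (s \ t).card = (t \ s).card := by
    have h1 := Finset.card_sdiff_add_card_inter s t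
    have h2 := Finset.card_sdiff_add_card_inter t s
    rw [Finset.inter_comm] at h2
    omega
  rw [hprod, ← Finset.prod_inter_mul_prod_sdiff s t, ← Finset.prod_inter_mul_prod_sdiff t s,
    Finset.inter_comm t s]
  refine mul_le_mul_of_nonneg_left ?_ (Finset.prod_nonneg fun i _ => hg0 i)
  rcases hkn.eq_or_lt with rfl | hlt
  · have h1 : s \ t = ∅ := by
      ext i
      simp [ht]
    have h2 : t \ s = ∅ := by
      rw [← Finset.card_eq_zero, ← hcard, h1, Finset.card_empty]
    rw [h1, h2]
  · calc ∏ i ∈ s \ t, g i ≤ ∏ _i ∈ s \ t, g ⟨k, hlt⟩ := by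
          refine Finset.prod_le_prod (fun i _ => hg0 i) fun i hi => hg ?_
          have := (Finset.mem_sdiff.mp hi).2
          simpa [ht, Fin.le_def] using this
      _ = ∏ _i ∈ t \ s, g ⟨k, hlt⟩ := by simp only [Finset.prod_const, hcard]
      _ ≤ ∏ i ∈ t \ s, g i := by
          refine Finset.prod_le_prod (fun i _ => hg0 _) fun i hi => hg ?_
          have := (Finset.mem_sdiff.mp hi).1
          exact Fin.le_def.mpr (Finset.mem_filter.mp this).2.le

lemma abs_det_mul_diagonal_mul_transpose_le {n k : ℕ} (hkn : k ≤ n)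
    (B : Matrix (Fin k) (Fin n) ℝ) (d : Fin n → ℝ) (hd : ∀ i j : Fin n, i ≤ j → |d j| ≤ |d i|) :
    |(B * Matrix.diagonal d * Bᵀ).det| ≤
      (∏ i ∈ Finset.univ.filter (fun i : Fin n => (i : ℕ) < k), |d i|) * (B * Bᵀ).det := by
  have hpos : (0 : ℝ) < k.factorial := by positivity
  have h1 := factorial_mul_det_mul_diagonal_mul_transpose B fun _ => 1
  have hone : Matrix.diagonal (fun _ : Fin n => (1 : ℝ)) = 1 := Matrix.diagonal_one
  simp only [hone, Matrix.mul_one, Finset.prod_const_one, one_mul] at h1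
  refine le_of_mul_le_mul_left ?_ hpos
  rw [mul_left_comm, h1, ← abs_of_pos hpos, ← abs_mul,
    factorial_mul_det_mul_diagonal_mul_transpose, Finset.mul_sum]
  refine (Finset.abs_sum_le_sum_abs _ _).trans (Finset.sum_le_sum fun f _ => ?_)
  rw [abs_mul, abs_of_nonneg (sq_nonneg (Bᵀ.submatrix f id).det), Finset.abs_prod]
  by_cases hf : Function.Injective f
  · exact mul_le_mul_of_nonneg_right
      (prod_comp_le_prod_filter_lt hkn (g := fun i => |d i|) hd (fun i => abs_nonneg _) hf)
      (sq_nonneg _)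
  · obtain ⟨i, j, hij, hne⟩ : ∃ i j, f i = f j ∧ i ≠ j := by
      simpa [Function.Injective] using hf
    have h0 : (Bᵀ.submatrix f id).det = 0 :=
      Matrix.det_zero_of_row_eq hne (by ext l; simp [hij])
    simp [h0]

/-- for a symmetric `A = V Λ Vᵀ` (`V` orthogonal) with eigenvalues
`λ₁, …, λ_n` (with multiplicity) sorted by decreasing absolute value, and a
full-row-rank `W ∈ ℝ^{k×n}` with pseudoinverse `W† = Wᵀ(WWᵀ)⁻¹`, we have
`0 ≤ |det(W A W†)| ≤ ∏_{i=1}^{k} |λ_i|`. -/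
theorem stmt1 {n k : ℕ} (hk : 1 ≤ k) (hkn : k ≤ n)
    (A V : Matrix (Fin n) (Fin n) ℝ) (lam : Fin n → ℝ)
    (hV : V * Vᵀ = 1) (hA : A = V * Matrix.diagonal lam * Vᵀ)
    (hsort : ∀ i j : Fin n, i ≤ j → |lam j| ≤ |lam i|)
    (W : Matrix (Fin k) (Fin n) ℝ) (hW : IsUnit (W * Wᵀ))
    (Wdag : Matrix (Fin n) (Fin k) ℝ) (hWdag : Wdag = Wᵀ * (W * Wᵀ)⁻¹) :
    0 ≤ |(W * A * Wdag).det| ∧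
    |(W * A * Wdag).det| ≤ ∏ i ∈ Finset.univ.filter (fun i : Fin n => (i : ℕ) < k), |lam i| := by
  refine ⟨abs_nonneg _, ?_⟩
  have hle := abs_det_mul_diagonal_mul_transpose_le hkn (W * V) lam hsort
  have hWA : W * V * Matrix.diagonal lam * (W * V)ᵀ = W * A * Wᵀ := by
    rw [hA, Matrix.transpose_mul]
    simp only [Matrix.mul_assoc]
  have hWW : W * V * (W * V)ᵀ = W * Wᵀ := by
    rw [Matrix.transpose_mul, Matrix.mul_assoc, ← Matrix.mul_assoc V, hV, Matrix.one_mul]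
  rw [hWA, hWW] at hle
  have hdet : 0 < (W * Wᵀ).det := by
    have hpsd : (W * Wᵀ).PosSemidef := by
      simpa using Matrix.posSemidef_self_mul_conjTranspose W
    exact hpsd.det_nonneg.lt_of_ne' ((Matrix.isUnit_iff_isUnit_det _).mp hW).ne_zero
  rw [hWdag, ← Matrix.mul_assoc, Matrix.det_mul, Matrix.det_nonsing_inv, Ring.inverse_eq_inv',
    abs_mul, abs_inv, abs_of_pos hdet, ← div_eq_mul_inv]
  exact (div_le_iff₀ hdet).mpr hle
end

section
/- Let A ∈ ℝ^{n×n} be symmetric positive definite with eigenvalues λ₁ ≥ λ₂ ≥ … ≥ λ_n > 0, and let W ∈ ℝ^{k×n} (1 ≤ k ≤ n) have full row rank, with W† = Wᵀ(W Wᵀ)⁻¹. Then ∏_{i=n−k+1}^{n} λ_i ≤ det(W A W†) ≤ ∏_{i=1}^{k} λ_i. -/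
open Matrix BigOperators

/-- The **Cauchy–Binet formula**, as a sum over all maps rather than over subsets. -/
theorem factorial_mul_det_mul {ι κ R : Type*} [Fintype ι] [DecidableEq ι] [Fintype κ]
    [DecidableEq κ] [CommRing R] (M : Matrix κ ι R) (N : Matrix ι κ R) :
    ((Fintype.card κ).factorial : R) * (M * N).det =
      ∑ f : κ → ι, (M.submatrix id f).det * (N.submatrix f id).det := by
  have expand : (M * N).det = ∑ f : κ → ι, (M.submatrix id f).det * ∏ i, N (f i) i := by
    simp only [det_apply', mul_apply, Finset.prod_univ_sum, Fintype.piFinset_univ,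
      Finset.mul_sum, Finset.sum_mul, submatrix_apply, id]
    rw [Finset.sum_comm]
    refine Finset.sum_congr rfl fun f _ => Finset.sum_congr rfl fun σ _ => ?_
    rw [Finset.prod_mul_distrib, mul_assoc]
  have permute (τ : Equiv.Perm κ) : (M * N).det =
      ∑ f : κ → ι, (M.submatrix id f).det *
        (((Equiv.Perm.sign τ : ℤ) : R) * ∏ i, N (f (τ i)) i) := by
    rw [expand, ← Equiv.sum_comp (Equiv.arrowCongr τ.symm (Equiv.refl ι))]
    refine Finset.sum_congr rfl fun f _ => ?_
    have h := det_permute' τ (M.submatrix id f)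
    rw [submatrix_submatrix] at h
    change (M.submatrix id (f ∘ τ)).det * ∏ i, N (f (τ i)) i = _
    rw [show M.submatrix id (f ∘ τ) = M.submatrix (id ∘ id) (f ∘ τ) from rfl, h]
    ring
  calc ((Fintype.card κ).factorial : R) * (M * N).det
      = ∑ _τ : Equiv.Perm κ, (M * N).det := by
        rw [Finset.sum_const, Finset.card_univ, Fintype.card_perm, nsmul_eq_mul]
    _ = _ := by
        rw [Finset.sum_congr rfl fun τ _ => permute τ, Finset.sum_comm]
        refine Finset.sum_congr rfl fun f _ => ?_
        rw [← Finset.mul_sum, det_apply' (N.submatrix f id)]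
        rfl

theorem factorial_mul_det_mul_diagonal_mul_transpose_s2 {ι κ R : Type*} [Fintype ι] [DecidableEq ι]
    [Fintype κ] [DecidableEq κ] [CommRing R] (U : Matrix κ ι R) (d : ι → R) :
    ((Fintype.card κ).factorial : R) * (U * diagonal d * Uᵀ).det =
      ∑ f : κ → ι, (∏ i, d (f i)) * (U.submatrix id f).det ^ 2 := by
  rw [factorial_mul_det_mul]
  refine Finset.sum_congr rfl fun f _ => ?_
  have h : (U * diagonal d).submatrix id f = U.submatrix id f * diagonal (d ∘ f) := by
    ext i j
    simp [mul_diagonal]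
  rw [h, det_mul, det_diagonal, ← transpose_submatrix, det_transpose]
  simp only [Function.comp_apply]
  ring

theorem prod_le_prod_of_card_eq_of_sdiff {ι : Type*} [DecidableEq ι] {d : ι → ℝ}
    (hd : ∀ i, 0 < d i) {S T : Finset ι} (hcard : S.card = T.card)
    (h : ∀ s ∈ S, s ∉ T → ∀ t ∈ T, t ∉ S → d s ≤ d t) :
    ∏ i ∈ S, d i ≤ ∏ i ∈ T, d i := by
  have e : ↥(S \ T) ≃ ↥(T \ S) :=
    Finset.equivOfCardEq (Finset.card_sdiff_comm hcard)
  have key : ∏ i ∈ S \ T, d i ≤ ∏ i ∈ T \ S, d i := by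
    rw [← Finset.prod_coe_sort (S \ T), ← Finset.prod_coe_sort (T \ S),
      ← Equiv.prod_comp e]
    refine Finset.prod_le_prod (fun i _ => (hd i).le) fun i _ => ?_
    have hi := Finset.mem_sdiff.1 i.2
    have hei := Finset.mem_sdiff.1 (e i).2
    exact h _ hi.1 hi.2 _ hei.1 hei.2
  rw [← Finset.prod_inter_mul_prod_sdiff S T, ← Finset.prod_inter_mul_prod_sdiff T S,
    Finset.inter_comm T S]
  exact mul_le_mul_of_nonneg_left key (Finset.prod_nonneg fun i _ => (hd i).le)

/-- If all products of `d` over `card κ` distinct indices lie in `[a, b]`, then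
`det (U D Uᵀ)` lies between `a * det (U Uᵀ)` and `b * det (U Uᵀ)`. -/
theorem det_mul_diagonal_mul_transpose_mem_Icc {ι κ : Type*} [Fintype ι] [DecidableEq ι]
    [Fintype κ] [DecidableEq κ] (U : Matrix κ ι ℝ) (d : ι → ℝ) {a b : ℝ}
    (h : ∀ f : κ → ι, Function.Injective f → ∏ i, d (f i) ∈ Set.Icc a b) :
    (U * diagonal d * Uᵀ).det ∈ Set.Icc (a * (U * Uᵀ).det) (b * (U * Uᵀ).det) := by
  have hfac : (0 : ℝ) < (Fintype.card κ).factorial := by positivity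
  have hone : ((Fintype.card κ).factorial : ℝ) * (U * Uᵀ).det =
      ∑ f : κ → ι, (U.submatrix id f).det ^ 2 := by
    simpa using factorial_mul_det_mul_diagonal_mul_transpose_s2 U (fun _ => (1 : ℝ))
  have hterm (f : κ → ι) : (∏ i, d (f i)) * (U.submatrix id f).det ^ 2 ∈
      Set.Icc (a * (U.submatrix id f).det ^ 2) (b * (U.submatrix id f).det ^ 2) := by
    by_cases hf : Function.Injective f
    · exact ⟨mul_le_mul_of_nonneg_right (h f hf).1 (sq_nonneg _),
        mul_le_mul_of_nonneg_right (h f hf).2 (sq_nonneg _)⟩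
    · obtain ⟨i, j, hij, hne⟩ : ∃ i j, f i = f j ∧ i ≠ j := by
        simpa [Function.Injective] using hf
      have hdet : (U.submatrix id f).det = 0 :=
        det_zero_of_column_eq hne fun l => by simp [hij]
      simp [hdet]
  constructor <;> refine le_of_mul_le_mul_left ?_ hfac <;>
    rw [mul_left_comm, hone, factorial_mul_det_mul_diagonal_mul_transpose_s2, Finset.mul_sum]
  · exact Finset.sum_le_sum fun f _ => (hterm f).1
  · exact Finset.sum_le_sum fun f _ => (hterm f).2

theorem det_mul_transpose_self_nonneg {ι κ : Type*} [Fintype ι] [Fintype κ] [DecidableEq κ]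
    (U : Matrix κ ι ℝ) : 0 ≤ (U * Uᵀ).det := by
  simpa using (posSemidef_self_mul_conjTranspose U).det_nonneg

/-- for a symmetric positive definite `A = V Λ Vᵀ` (`V` orthogonal)
with eigenvalues `λ₁ ≥ … ≥ λ_n > 0` (with multiplicity), and a full-row-rank
`W ∈ ℝ^{k×n}` with pseudoinverse `W† = Wᵀ(WWᵀ)⁻¹`, we have
`∏_{i=n−k+1}^{n} λ_i ≤ det(W A W†) ≤ ∏_{i=1}^{k} λ_i`. -/
theorem stmt2 {n k : ℕ} (hk : 1 ≤ k) (hkn : k ≤ n)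
    (A V : Matrix (Fin n) (Fin n) ℝ) (lam : Fin n → ℝ)
    (hV : V * Vᵀ = 1) (hA : A = V * Matrix.diagonal lam * Vᵀ)
    (hpos : ∀ i, 0 < lam i)
    (hsort : ∀ i j : Fin n, i ≤ j → lam j ≤ lam i)
    (hApd : A.PosDef)
    (W : Matrix (Fin k) (Fin n) ℝ) (hW : IsUnit (W * Wᵀ))
    (Wdag : Matrix (Fin n) (Fin k) ℝ) (hWdag : Wdag = Wᵀ * (W * Wᵀ)⁻¹) :
    (∏ i ∈ Finset.univ.filter (fun i : Fin n => n - k ≤ (i : ℕ)), lam i) ≤ (W * A * Wdag).det ∧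
    (W * A * Wdag).det ≤ ∏ i ∈ Finset.univ.filter (fun i : Fin n => (i : ℕ) < k), lam i := by
  have hprod (f : Fin k → Fin n) (hf : Function.Injective f) : ∏ i, lam (f i) ∈ Set.Icc
      (∏ i ∈ Finset.univ.filter (fun i : Fin n => n - k ≤ (i : ℕ)), lam i)
      (∏ i ∈ Finset.univ.filter (fun i : Fin n => (i : ℕ) < k), lam i) := by
    have himage : ∏ i, lam (f i) = ∏ i ∈ Finset.univ.image f, lam i :=
      (Finset.prod_image hf.injOn).symm
    have hcard : (Finset.univ.image f).card = k := by
      simp [Finset.card_image_of_injective _ hf]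
    have hfirst (m : ℕ) (hm : m ≤ n) :
        (Finset.univ.filter (fun i : Fin n => (i : ℕ) < m)).card = m := by
      simp [Fin.card_filter_val_lt, hm]
    have hlast : (Finset.univ.filter (fun i : Fin n => n - k ≤ (i : ℕ))).card = k := by
      have h := Finset.card_filter_add_card_filter_not (s := Finset.univ)
        (fun i : Fin n => (i : ℕ) < n - k)
      simp only [not_lt, hfirst (n - k) (Nat.sub_le n k), Finset.card_univ,
        Fintype.card_fin] at h
      omega
    rw [himage]
    constructor
    · refine prod_le_prod_of_card_eq_of_sdiff hpos (hlast.trans hcard.symm)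
        fun s hs _ t _ ht => hsort t s ?_
      simp only [Finset.mem_filter, Finset.mem_univ, true_and, not_le] at hs ht
      exact Fin.le_def.2 (ht.le.trans hs)
    · refine prod_le_prod_of_card_eq_of_sdiff hpos (hcard.trans (hfirst k hkn).symm)
        fun s _ hs t ht _ => hsort t s ?_
      simp only [Finset.mem_filter, Finset.mem_univ, true_and, not_lt] at hs ht
      exact Fin.le_def.2 (ht.le.trans hs)
  have hgram : (W * V) * (W * V)ᵀ = W * Wᵀ := by
    rw [transpose_mul, Matrix.mul_assoc, ← Matrix.mul_assoc V, hV, Matrix.one_mul]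
  have hdet_pos : 0 < (W * Wᵀ).det :=
    (det_mul_transpose_self_nonneg W).lt_of_ne' ((isUnit_iff_isUnit_det _).1 hW).ne_zero
  have hdet : (W * A * Wdag).det =
      ((W * V) * diagonal lam * (W * V)ᵀ).det / (W * Wᵀ).det := by
    have h : W * A * Wdag = (W * V) * diagonal lam * (W * V)ᵀ * (W * Wᵀ)⁻¹ := by
      simp only [hA, hWdag, transpose_mul, Matrix.mul_assoc]
    rw [h, det_mul, det_nonsing_inv, Ring.inverse_eq_inv', div_eq_mul_inv]
  have hbounds := det_mul_diagonal_mul_transpose_mem_Icc (W * V) lam hprod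
  rw [hgram] at hbounds
  rw [hdet, le_div_iff₀ hdet_pos, div_le_iff₀ hdet_pos]
  exact hbounds
end

section
/- Let B ∈ ℝ^{k×n} (1 ≤ k ≤ n) have full row rank (B Bᵀ invertible), let B† = Bᵀ(B Bᵀ)⁻¹, and let Λ = diag(λ₁, …, λ_n) be a real diagonal matrix. For a k-element subset S ⊆ {1, …, n}, let B_S denote the k×k submatrix of B formed by the columns indexed by S. Then det(B Bᵀ) = Σ_{|S|=k} det(B_S)² > 0 and det(B Λ B†) = (Σ_{|S|=k} det(B_S)² · ∏_{i∈S} λ_i) / (Σ_{|S|=k} det(B_S)²); that is, det(B Λ B†) is a convex combination of the products ∏_{i∈S} λ_i over all k-element subsets S, with nonnegative weights det(B_S)²/det(B Bᵀ) summing to 1. -/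
open Matrix BigOperators

/-- The determinant of the `k×k` submatrix of `B ∈ ℝ^{k×n}` formed by the
columns indexed by a `k`-element subset `S` of `{1, …, n}` (columns taken in
increasing order). -/
noncomputable def colSubDet {k n : ℕ} (B : Matrix (Fin k) (Fin n) ℝ)
    (S : Finset (Fin n)) (hS : S.card = k) : ℝ :=
  (B.submatrix id (fun i : Fin k => ((S.orderIsoOfFin hS) i).1)).det

namespace Matrix

variable {R : Type*} [CommRing R] {m ι : Type*} [Fintype m] [DecidableEq m]

/-- Expansion of the determinant of a product along all selections of columns. -/
theorem det_mul_eq_sum_det_submatrix [Fintype ι] (M : Matrix m ι R) (N : Matrix ι m R) :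
    (M * N).det = ∑ p : m → ι, (M.submatrix id p).det * ∏ i, N (p i) i := by
  classical
  simp only [det_apply', mul_apply, Finset.prod_univ_sum, Finset.mul_sum,
    Fintype.piFinset_univ, Finset.sum_mul]
  rw [Finset.sum_comm]
  simp only [Finset.prod_mul_distrib, submatrix_apply, id_eq, mul_assoc]

theorem det_submatrix_eq_zero_of_not_injective (M : Matrix m ι R) {p : m → ι}
    (hp : ¬ Function.Injective p) : (M.submatrix id p).det = 0 := by
  simp only [Function.Injective, not_forall] at hp
  obtain ⟨i, j, hij, hne⟩ := hp
  exact det_zero_of_column_eq hne fun r => by simp [hij]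

/-- The Cauchy–Binet formula. -/
theorem det_mul_eq_sum_subsets {k n : ℕ} (M : Matrix (Fin k) (Fin n) R)
    (N : Matrix (Fin n) (Fin k) R) :
    (M * N).det = ∑ S : {S : Finset (Fin n) // S.card = k},
      (M.submatrix id (fun i => (S.1.orderIsoOfFin S.2 i).1)).det *
        (N.submatrix (fun i => (S.1.orderIsoOfFin S.2 i).1) id).det := by
  rw [det_mul_eq_sum_det_submatrix]
  have expand : ∀ S : {S : Finset (Fin n) // S.card = k},
      (M.submatrix id (fun i => (S.1.orderIsoOfFin S.2 i).1)).det *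
        (N.submatrix (fun i => (S.1.orderIsoOfFin S.2 i).1) id).det =
      ∑ τ : Equiv.Perm (Fin k),
        (M.submatrix id (fun i => (S.1.orderIsoOfFin S.2 (τ i)).1)).det *
          ∏ i, N (S.1.orderIsoOfFin S.2 (τ i)).1 i := by
    intro S
    rw [det_apply' (N.submatrix _ _), Finset.mul_sum]
    refine Finset.sum_congr rfl fun τ _ => ?_
    have h := det_permute' τ (M.submatrix id (fun i => (S.1.orderIsoOfFin S.2 i).1))
    rw [submatrix_submatrix] at h
    change (M.submatrix id (fun i => (S.1.orderIsoOfFin S.2 (τ i)).1)).det = _ at h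
    rw [h]
    simp only [submatrix_apply, id_eq]
    ring
  simp_rw [expand]
  rw [← Fintype.sum_prod_type']
  symm
  refine Finset.sum_of_injOn
    (fun x : {S : Finset (Fin n) // S.card = k} × Equiv.Perm (Fin k) =>
      fun i => (x.1.1.orderIsoOfFin x.1.2 (x.2 i)).1) ?_ (by simp) ?_ (fun _ _ => rfl)
  · rintro ⟨S, τ⟩ - ⟨T, σ⟩ - h
    have range_eq : ∀ (S : {S : Finset (Fin n) // S.card = k}) (τ : Equiv.Perm (Fin k)),
        Set.range (fun i => (S.1.orderIsoOfFin S.2 (τ i)).1) = S.1 := by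
      intro S τ
      have := ((τ.trans (S.1.orderIsoOfFin S.2).toEquiv).surjective).range_comp
        (Subtype.val : S.1 → Fin n)
      rw [Subtype.range_coe] at this
      exact this
    have hST : S = T := by
      apply Subtype.ext
      apply Finset.coe_injective
      rw [← range_eq S τ, ← range_eq T σ]
      exact congrArg Set.range h
    subst hST
    refine Prod.ext rfl (Equiv.ext fun i => ?_)
    exact (S.1.orderIsoOfFin S.2).injective (Subtype.ext (congrFun h i))
  · intro p _ hp
    rw [det_submatrix_eq_zero_of_not_injective, zero_mul]
    intro hinj
    apply hp
    let S : {S : Finset (Fin n) // S.card = k} :=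
      ⟨Finset.univ.image p, by rw [Finset.card_image_of_injective _ hinj]; simp⟩
    let q : Fin k → Fin k := fun i =>
      (S.1.orderIsoOfFin S.2).symm ⟨p i, Finset.mem_image_of_mem p (Finset.mem_univ i)⟩
    have hq : Function.Injective q := fun i j h =>
      hinj (congrArg Subtype.val ((S.1.orderIsoOfFin S.2).symm.injective h))
    refine ⟨(S, Equiv.ofBijective q (Finite.injective_iff_bijective.1 hq)), by simp, ?_⟩
    funext i
    simp [q]

end Matrix

theorem det_mul_diagonal_mul_transpose {k n : ℕ} (B : Matrix (Fin k) (Fin n) ℝ)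
    (lam : Fin n → ℝ) :
    (B * Matrix.diagonal lam * Bᵀ).det =
      ∑ S : {S : Finset (Fin n) // S.card = k},
        (colSubDet B S.1 S.2) ^ 2 * ∏ i ∈ S.1, lam i := by
  rw [Matrix.mul_assoc, det_mul_eq_sum_subsets]
  refine Finset.sum_congr rfl fun S _ => ?_
  have hsub : (Matrix.diagonal lam * Bᵀ).submatrix
      (fun i => (S.1.orderIsoOfFin S.2 i).1) id =
      Matrix.diagonal (fun i => lam (S.1.orderIsoOfFin S.2 i).1) *
        (B.submatrix id (fun i => (S.1.orderIsoOfFin S.2 i).1))ᵀ := by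
    ext i j
    simp [Matrix.diagonal_mul]
  have hprod : ∏ i, lam (S.1.orderIsoOfFin S.2 i).1 = ∏ i ∈ S.1, lam i := by
    rw [← Finset.prod_coe_sort S.1 lam]
    exact (S.1.orderIsoOfFin S.2).toEquiv.prod_comp (fun x : S.1 => lam x.1)
  rw [hsub, det_mul, det_diagonal, det_transpose, hprod, colSubDet]
  ring

/-- for full-row-rank `B ∈ ℝ^{k×n}` with pseudoinverse
`B† = Bᵀ(BBᵀ)⁻¹` and a real diagonal matrix `Λ = diag(λ₁,…,λ_n)`, Cauchy–Binet
gives `det(BBᵀ) = Σ_{|S|=k} det(B_S)² > 0`, and `det(B Λ B†)` is the convex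
combination `(Σ_{|S|=k} det(B_S)² ∏_{i∈S} λ_i) / (Σ_{|S|=k} det(B_S)²)` of the
products `∏_{i∈S} λ_i`. -/
theorem stmt3 {n k : ℕ} (hk : 1 ≤ k) (hkn : k ≤ n)
    (B : Matrix (Fin k) (Fin n) ℝ) (hB : IsUnit (B * Bᵀ))
    (Bdag : Matrix (Fin n) (Fin k) ℝ) (hBdag : Bdag = Bᵀ * (B * Bᵀ)⁻¹)
    (lam : Fin n → ℝ) :
    0 < (B * Bᵀ).det ∧
    (B * Bᵀ).det = ∑ S : {S : Finset (Fin n) // S.card = k}, (colSubDet B S.1 S.2) ^ 2 ∧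
    (B * Matrix.diagonal lam * Bdag).det =
      (∑ S : {S : Finset (Fin n) // S.card = k},
          (colSubDet B S.1 S.2) ^ 2 * ∏ i ∈ S.1, lam i) /
        (∑ S : {S : Finset (Fin n) // S.card = k}, (colSubDet B S.1 S.2) ^ 2) := by
  have hsum : (B * Bᵀ).det =
      ∑ S : {S : Finset (Fin n) // S.card = k}, (colSubDet B S.1 S.2) ^ 2 := by
    simpa using det_mul_diagonal_mul_transpose B (fun _ => 1)
  have hne : (B * Bᵀ).det ≠ 0 := ((Matrix.isUnit_iff_isUnit_det _).1 hB).ne_zero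
  have hnonneg : 0 ≤ (B * Bᵀ).det := by
    rw [hsum]
    exact Finset.sum_nonneg fun _ _ => sq_nonneg _
  refine ⟨lt_of_le_of_ne hnonneg hne.symm, hsum, ?_⟩
  rw [← hsum, ← det_mul_diagonal_mul_transpose, hBdag, ← Matrix.mul_assoc, det_mul,
    det_nonsing_inv, Ring.inverse_eq_inv', div_eq_mul_inv]
end

section
/- Let Σ ∈ ℝ^{n×n} be symmetric positive definite with eigenvalues κ₁ ≥ κ₂ ≥ … ≥ κ_n > 0 (with multiplicity), and let W ∈ ℝ^{k×n} (1 ≤ k ≤ n) have full row rank with singular values s_{W,1} ≥ … ≥ s_{W,k} > 0. Then det(W Σ Wᵀ) ≤ ∏_{i=1}^{k} s_{W,i}² · κ_i. -/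
open Matrix BigOperators

/-- The Cauchy–Binet formula for a Gram determinant: `det (A Aᵀ)` is the sum of the squares of the
maximal minors of `A`. -/
theorem det_mul_transpose_self_eq_sum_sq_minors {k : ℕ} {ι : Type*} [Fintype ι] [LinearOrder ι]
    (A : Matrix (Fin k) ι ℝ) :
    (A * Aᵀ).det = ∑ s : Set.powersetCard ι k,
      (A.submatrix id (Set.powersetCard.ofFinEmbEquiv.symm s)).det ^ 2 := by
  let x : Fin k → EuclideanSpace ℝ ι := fun i => WithLp.toLp 2 (A i)
  let b := (EuclideanSpace.basisFun ι ℝ).exteriorPower k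
  have hb (s : Set.powersetCard ι k) : b s = exteriorPower.ιMulti_family ℝ k
      (EuclideanSpace.basisFun ι ℝ) s := by
    rw [← b.coe_toBasis, OrthonormalBasis.toBasis_exteriorPower, exteriorPower.coe_basis,
      OrthonormalBasis.coe_toBasis]
  have hgram : A * Aᵀ = gram ℝ x := by
    ext i j
    simp [x, gram, mul_apply, PiLp.inner_apply, mul_comm]
  rw [hgram, ← exteriorPower.inner_ιMulti_self, real_inner_self_eq_norm_sq,
    ← b.sum_sq_inner_right]
  refine Finset.sum_congr rfl fun s _ => ?_
  rw [hb, exteriorPower.ιMulti_family, exteriorPower.inner_ιMulti_ιMulti]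
  congr 2
  ext i j
  simp [x, EuclideanSpace.inner_single_left]

theorem det_mul_diagonal_mul_transpose_le {n k : ℕ} (hkn : k ≤ n) {c : Fin n → ℝ}
    (hc : ∀ i, 0 ≤ c i) (hanti : Antitone c) (A : Matrix (Fin k) (Fin n) ℝ) :
    (A * diagonal c * Aᵀ).det ≤ (A * Aᵀ).det * ∏ i, c (Fin.castLE hkn i) := by
  have hsplit : A * diagonal c * Aᵀ =
      (A * diagonal fun i => √(c i)) * (A * diagonal fun i => √(c i))ᵀ := by
    rw [transpose_mul, diagonal_transpose, Matrix.mul_assoc A (diagonal fun i => √(c i)),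
      ← Matrix.mul_assoc (diagonal _) (diagonal _) Aᵀ, diagonal_mul_diagonal, Matrix.mul_assoc]
    simp only [Real.mul_self_sqrt (hc _)]
  rw [hsplit, det_mul_transpose_self_eq_sum_sq_minors, det_mul_transpose_self_eq_sum_sq_minors,
    Finset.sum_mul]
  refine Finset.sum_le_sum fun s _ => ?_
  set f := Set.powersetCard.ofFinEmbEquiv.symm s
  have hminor : (A * diagonal fun i => √(c i)).submatrix id f =
      A.submatrix id f * diagonal fun i => √(c (f i)) := by
    ext i j
    simp
  have hle (i : Fin k) : Fin.castLE hkn i ≤ f i := by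
    obtain ⟨i, hi⟩ := i
    rw [Fin.le_def]
    induction i with
    | zero => simp
    | succ i ih =>
      have hlt : f ⟨i, by omega⟩ < f ⟨i + 1, hi⟩ := f.strictMono (by simp)
      exact (ih (by omega)).trans_lt hlt
  rw [hminor, det_mul, det_diagonal, mul_pow, ← Finset.prod_pow]
  simp only [Real.sq_sqrt (hc _)]
  gcongr with i
  · exact fun i _ => hc _
  · exact hanti (hle i)

/-- let `Σ = V K Vᵀ` be symmetric positive definite with
eigenvalues `κ₁ ≥ … ≥ κ_n > 0` (with multiplicity, `V` orthogonal), and let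
`W ∈ ℝ^{k×n}` have full row rank with singular values
`s_{W,1} ≥ … ≥ s_{W,k} > 0` (so `W Wᵀ = U diag(s²) Uᵀ` for some orthogonal `U`).
Then `det(W Σ Wᵀ) ≤ ∏_{i=1}^{k} s_{W,i}² κ_i`. -/
theorem stmt4 {n k : ℕ} (hk : 1 ≤ k) (hkn : k ≤ n)
    (Sg V : Matrix (Fin n) (Fin n) ℝ) (kap : Fin n → ℝ)
    (hV : V * Vᵀ = 1) (hSg : Sg = V * Matrix.diagonal kap * Vᵀ)
    (hkpos : ∀ i, 0 < kap i)
    (hksort : ∀ i j : Fin n, i ≤ j → kap j ≤ kap i)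
    (W : Matrix (Fin k) (Fin n) ℝ)
    (s : Fin k → ℝ) (hspos : ∀ i, 0 < s i)
    (hssort : ∀ i j : Fin k, i ≤ j → s j ≤ s i)
    (U : Matrix (Fin k) (Fin k) ℝ) (hU : U * Uᵀ = 1)
    (hWWt : W * Wᵀ = U * Matrix.diagonal (fun i => s i ^ 2) * Uᵀ) :
    (W * Sg * Wᵀ).det ≤ ∏ i : Fin k, s i ^ 2 * kap (Fin.castLE hkn i) := by
  have hWV : W * V * (W * V)ᵀ = W * Wᵀ := by
    rw [transpose_mul, Matrix.mul_assoc, ← Matrix.mul_assoc V, hV, Matrix.one_mul]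
  have hdet : (W * Wᵀ).det = ∏ i, s i ^ 2 := by
    rw [hWWt, det_mul_right_comm, hU, Matrix.one_mul, det_diagonal]
  have hconj : W * Sg * Wᵀ = W * V * diagonal kap * (W * V)ᵀ := by
    rw [hSg, transpose_mul]
    simp only [Matrix.mul_assoc]
  rw [hconj, Finset.prod_mul_distrib, ← hdet, ← hWV]
  exact det_mul_diagonal_mul_transpose_le hkn (fun i => (hkpos i).le) (fun i j => hksort i j) _
end

section
/- Let A = V Λ Vᵀ ∈ ℝ^{n×n} where V ∈ ℝ^{n×n} is orthogonal and Λ = diag(λ₁, …, λ_n) with |λ₁| ≥ … ≥ |λ_n| > 0, let Σ ∈ ℝ^{n×n} be symmetric positive definite, let 1 ≤ k ≤ n, and let η > 0. If (1/n)·Σ_{i=1}^{n} ln|λ_i| − (1/k)·Σ_{i=1}^{k} ln|λ_i| < η, then there exists W ∈ ℝ^{k×n} of full row rank satisfying det(W Σ Wᵀ)^{1/k} ≥ e^{−2η} · det(Σ)^{1/n} such that Δ𝒥(W) > 0. -/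
open Matrix BigOperators

/-- The causal emergence of the coarse-graining `W`:
`Δ𝒥(W) = ln(|det(WAW†)|^{1/k}/|det A|^{1/n}) + ln((det Σ)^{1/2n}/(det(WΣWᵀ))^{1/2k})`
with `W† = Wᵀ(WWᵀ)⁻¹`. -/
noncomputable def deltaJ {n k : ℕ} (A Sg : Matrix (Fin n) (Fin n) ℝ)
    (W : Matrix (Fin k) (Fin n) ℝ) : ℝ :=
  Real.log (|(W * A * (Wᵀ * (W * Wᵀ)⁻¹)).det| ^ ((1 : ℝ) / k) / |A.det| ^ ((1 : ℝ) / n)) +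
  Real.log (Sg.det ^ (1 / (2 * (n : ℝ))) / (W * Sg * Wᵀ).det ^ (1 / (2 * (k : ℝ))))

/-- If `U` has orthonormal rows, then for `c ≠ 0` the
pseudoinverse of `c • U` is `c⁻¹ • Uᵀ`, so `W A W†` does not depend on `c`. -/
theorem smul_mul_mul_pinv {m n : Type*} [Fintype m] [DecidableEq m] [Fintype n]
    (A : Matrix n n ℝ) (U : Matrix m n ℝ) (hU : U * Uᵀ = 1) {c : ℝ} (hc : c ≠ 0) :
    (c • U) * A * ((c • U)ᵀ * ((c • U) * (c • U)ᵀ)⁻¹) = U * A * Uᵀ := by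
  have hinv : ((c • U) * (c • U)ᵀ)⁻¹ = (c * c)⁻¹ • (1 : Matrix m m ℝ) := by
    apply Matrix.inv_eq_right_inv
    simp only [transpose_smul, Matrix.smul_mul, Matrix.mul_smul, hU, smul_smul, mul_one]
    rw [show (c * c)⁻¹ * (c * c) = 1 by field_simp, one_smul]
  rw [hinv]
  simp only [transpose_smul, Matrix.smul_mul, Matrix.mul_smul, smul_smul, Matrix.mul_one]
  rw [show (c * c)⁻¹ * c * c = 1 by field_simp, one_smul]

theorem det_smul_mul_mul_transpose {m n : Type*} [Fintype m] [DecidableEq m] [Fintype n]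
    (S : Matrix n n ℝ) (U : Matrix m n ℝ) (c : ℝ) :
    ((c • U) * S * (c • U)ᵀ).det = (c * c) ^ Fintype.card m * (U * S * Uᵀ).det := by
  simp only [transpose_smul, Matrix.smul_mul, Matrix.mul_smul, smul_smul, det_smul]

/-- A positive definite matrix stays positive definite after compression by orthonormal rows. -/
theorem posDef_mul_mul_transpose {m n : Type*} [Fintype m] [DecidableEq m] [Fintype n]
    {S : Matrix n n ℝ} (hS : S.PosDef) {U : Matrix m n ℝ} (hU : U * Uᵀ = 1) :
    (U * S * Uᵀ).PosDef := by
  rw [← conjTranspose_eq_transpose_of_trivial]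
  refine hS.mul_mul_conjTranspose_same fun x y hxy => ?_
  have h := congrArg (· ᵥ* Uᵀ) hxy
  simpa [vecMul_vecMul, hU] using h

/-- The causal emergence in terms of logarithms. -/
theorem deltaJ_eq {n k : ℕ} (A Sg : Matrix (Fin n) (Fin n) ℝ) (W : Matrix (Fin k) (Fin n) ℝ)
    (hA : A.det ≠ 0) (hW : (W * A * (Wᵀ * (W * Wᵀ)⁻¹)).det ≠ 0) (hSg : 0 < Sg.det)
    (hWSg : 0 < (W * Sg * Wᵀ).det) :
    deltaJ A Sg W =
      1 / (k : ℝ) * Real.log |(W * A * (Wᵀ * (W * Wᵀ)⁻¹)).det| - 1 / (n : ℝ) * Real.log |A.det| +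
      (1 / (2 * (n : ℝ)) * Real.log Sg.det -
        1 / (2 * (k : ℝ)) * Real.log (W * Sg * Wᵀ).det) := by
  have h₁ := abs_pos.2 hA
  have h₂ := abs_pos.2 hW
  rw [deltaJ, Real.log_div (by positivity) (by positivity),
    Real.log_div (by positivity) (by positivity), Real.log_rpow h₂, Real.log_rpow h₁,
    Real.log_rpow hSg, Real.log_rpow hWSg]

theorem log_abs_prod {ι : Type*} (s : Finset ι) (f : ι → ℝ) (hf : ∀ i, f i ≠ 0) :
    Real.log |∏ i ∈ s, f i| = ∑ i ∈ s, Real.log |f i| := by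
  rw [Finset.abs_prod, Real.log_prod fun i _ => abs_ne_zero.2 (hf i)]

theorem sum_castLE {n k : ℕ} (hkn : k ≤ n) (f : Fin n → ℝ) :
    ∑ i : Fin k, f (Fin.castLE hkn i) =
      ∑ i ∈ Finset.univ.filter (fun i : Fin n => (i : ℕ) < k), f i := by
  refine Finset.sum_bij (fun i _ => Fin.castLE hkn i) (by simp) (by simp) ?_ (by simp)
  intro b hb
  exact ⟨⟨b, by simpa using hb⟩, by simp, rfl⟩

/-- for `A = V Λ Vᵀ` (`V` orthogonal, `|λ₁| ≥ … ≥ |λ_n| > 0`),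
`Σ` symmetric positive definite, `1 ≤ k ≤ n`, and `η > 0`, if
`(1/n) Σ_{i≤n} ln|λ_i| − (1/k) Σ_{i≤k} ln|λ_i| < η` then there exists a
full-row-rank `W ∈ ℝ^{k×n}` satisfying `det(WΣWᵀ)^{1/k} ≥ e^{−2η} (det Σ)^{1/n}`
with strictly positive causal emergence `Δ𝒥(W) > 0`. -/
theorem stmt10 {n k : ℕ} (hk : 1 ≤ k) (hkn : k ≤ n)
    (V : Matrix (Fin n) (Fin n) ℝ) (hV : V * Vᵀ = 1) (hV' : Vᵀ * V = 1)
    (lam : Fin n → ℝ) (hlam : ∀ i, lam i ≠ 0)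
    (hsort : ∀ i j : Fin n, i ≤ j → |lam j| ≤ |lam i|)
    (A : Matrix (Fin n) (Fin n) ℝ) (hA : A = V * Matrix.diagonal lam * Vᵀ)
    (Sg : Matrix (Fin n) (Fin n) ℝ) (hSg : Sg.PosDef)
    (η : ℝ) (hη : 0 < η)
    (hgap : (1 / (n : ℝ)) * (∑ i : Fin n, Real.log |lam i|) -
        (1 / (k : ℝ)) * (∑ i ∈ Finset.univ.filter (fun i : Fin n => (i : ℕ) < k),
          Real.log |lam i|) < η) :
    ∃ W : Matrix (Fin k) (Fin n) ℝ,
      IsUnit (W * Wᵀ) ∧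
      (W * Sg * Wᵀ).det ^ (1 / (k : ℝ)) ≥ Real.exp (-(2 * η)) * Sg.det ^ (1 / (n : ℝ)) ∧
      0 < deltaJ A Sg W := by
  have hn0 : (n : ℝ) ≠ 0 := by norm_cast; omega
  have hk0 : (k : ℝ) ≠ 0 := by norm_cast; omega
  set e := Fin.castLE hkn
  have he : Function.Injective e := Fin.castLE_injective hkn
  let U : Matrix (Fin k) (Fin n) ℝ := Vᵀ.submatrix e id
  have hcomp (M : Matrix (Fin n) (Fin n) ℝ) : U * M * Uᵀ = (Vᵀ * M * V).submatrix e e := rfl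
  have hU : U * Uᵀ = 1 := by
    have h := hcomp 1
    rwa [Matrix.mul_one, Matrix.mul_one, hV', submatrix_one _ he] at h
  have hUA : U * A * Uᵀ = diagonal (lam ∘ e) := by
    rw [hcomp, hA, show Vᵀ * (V * diagonal lam * Vᵀ) * V = (Vᵀ * V) * diagonal lam * (Vᵀ * V) by
      simp only [Matrix.mul_assoc], hV', Matrix.one_mul, Matrix.mul_one, submatrix_diagonal _ _ he]
  have hAdet : A.det = ∏ i, lam i := by
    rw [hA, det_mul_right_comm, hV, Matrix.one_mul, det_diagonal]
  have hs : 0 < Sg.det := hSg.det_pos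
  have hd : 0 < (U * Sg * Uᵀ).det := (posDef_mul_mul_transpose hSg hU).det_pos
  let t := (-(2 * η) + Real.log Sg.det / n - Real.log (U * Sg * Uᵀ).det / k) / 2
  have hc : Real.exp t ≠ 0 := (Real.exp_pos t).ne'
  have hdet : ((Real.exp t • U) * Sg * (Real.exp t • U)ᵀ).det =
      Real.exp (k * (-(2 * η) + Real.log Sg.det / n)) := by
    rw [det_smul_mul_mul_transpose, Fintype.card_fin, ← Real.exp_add, ← Real.exp_nat_mul]
    refine (congrArg _ (Real.exp_log hd).symm).trans ?_
    rw [← Real.exp_add]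
    congr 1
    simp only [t]
    field_simp
    ring
  have hWA := smul_mul_mul_pinv A U hU hc
  refine ⟨Real.exp t • U, ?_, ?_, ?_⟩
  · rw [transpose_smul, Matrix.smul_mul, Matrix.mul_smul, hU, isUnit_iff_isUnit_det]
    simp [smul_smul]
  · rw [hdet, ← Real.exp_mul, Real.rpow_def_of_pos hs, ← Real.exp_add]
    refine (congrArg Real.exp ?_).ge
    field_simp
  · rw [deltaJ_eq A Sg _ ?_ ?_ hs (hdet ▸ Real.exp_pos _), hdet, hWA, hUA, det_diagonal, hAdet,
      log_abs_prod _ _ hlam, log_abs_prod _ (lam ∘ e) fun i => hlam (e i), Real.log_exp]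
    · have hsum := sum_castLE hkn fun i => Real.log |lam i|
      rw [← hsum] at hgap
      have hlin : 1 / (2 * (n : ℝ)) * Real.log Sg.det -
          1 / (2 * (k : ℝ)) * (k * (-(2 * η) + Real.log Sg.det / n)) = η := by
        field_simp
        ring
      rw [hlin]
      simp only [Function.comp_apply]
      linarith
    · rw [hAdet]
      exact Finset.prod_ne_zero_iff.2 fun i _ => hlam i
    · rw [hWA, hUA, det_diagonal]
      exact Finset.prod_ne_zero_iff.2 fun i _ => hlam (e i)
end

section
/- Let V ∈ ℝ^{n×n} be orthogonal, let A = V Λ Vᵀ with Λ = diag(λ₁, …, λ_n) real diagonal and all λ_i ≠ 0, and let Σ = V K Vᵀ with K = diag(κ₁, …, κ_n) and all κ_i > 0 (so A and Σ share the eigenvector matrix V). Let d̃₁, …, d̃_n be the numbers λ_i/√κ_i rearranged so that |d̃₁| ≥ … ≥ |d̃_n|. Then for every 1 ≤ k ≤ n and every W ∈ ℝ^{k×n} with W Wᵀ = I_k (so that W† = Wᵀ) and det(W A Wᵀ) ≠ 0, the causal emergence satisfies Δ𝒥(W) = ln(|det(W A Wᵀ)|^{1/k}/|det A|^{1/n})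 + ln((det Σ)^{1/(2n)}/(det(W Σ Wᵀ))^{1/(2k)}) ≤ (1/k)·Σ_{i=1}^{k} ln|d̃_i| − (1/n)·Σ_{i=1}^{n} ln|d̃_i|. -/
open Matrix BigOperators

namespace Matrix

variable {m n R : Type*} [Fintype m] [DecidableEq m] [Fintype n] [CommRing R]

/-- Expansion of the determinant of a product of rectangular matrices along the rows of the
right factor. -/
theorem det_mul_eq_sum_prod_mul_det_submatrix (M : Matrix m n R) (N : Matrix n m R) :
    (M * N).det = ∑ f : m → n, (∏ i, M i (f i)) * (N.submatrix f id).det := by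
  classical
  have hrow : M * N = fun i => ∑ j, M i j • N j := by
    ext i l
    simp [Matrix.mul_apply, Finset.sum_apply]
  have hsum := (detRowAlternating : (m → R) [⋀^m]→ₗ[R] R).toMultilinearMap.map_sum
    (fun i j => M i j • N j)
  rw [hrow]
  refine hsum.trans (Finset.sum_congr rfl fun f _ => ?_)
  exact (detRowAlternating : (m → R) [⋀^m]→ₗ[R] R).toMultilinearMap.map_smul_univ
    (fun i => M i (f i)) (fun i => N (f i))

/-- The **Cauchy–Binet formula**, summed over all maps `m → n` instead of over subsets of `n`. -/
theorem factorial_mul_det_mul (M : Matrix m n R) (N : Matrix n m R) :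
    ((Fintype.card m).factorial : R) * (M * N).det =
      ∑ f : m → n, (M.submatrix id f).det * (N.submatrix f id).det := by
  classical
  have hperm (σ : Equiv.Perm m) :
      ∑ f : m → n, ((Equiv.Perm.sign σ : ℤ) : R) * (∏ i, M (σ i) (f i)) *
        (N.submatrix f id).det = (M * N).det := by
    rw [det_mul_eq_sum_prod_mul_det_submatrix]
    refine (Fintype.sum_equiv (σ.arrowCongr (Equiv.refl n)).symm _ _ fun g => ?_).symm
    have hN : (N.submatrix (g ∘ σ) id).det =
        ((Equiv.Perm.sign σ : ℤ) : R) * (N.submatrix g id).det :=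
      det_permute σ (N.submatrix g id)
    have hM : ∏ i, M (σ i) (g (σ i)) = ∏ i, M i (g i) :=
      Equiv.prod_comp σ fun i => M i (g i)
    have hsign : ((Equiv.Perm.sign σ : ℤ) : R) * ((Equiv.Perm.sign σ : ℤ) : R) = 1 := by
      rw [← Int.cast_mul, ← Units.val_mul, Int.units_mul_self]
      simp
    change _ = ((Equiv.Perm.sign σ : ℤ) : R) * (∏ i, M (σ i) (g (σ i))) *
      (N.submatrix (g ∘ σ) id).det
    rw [hN, hM]
    linear_combination (-(∏ i, M i (g i)) * (N.submatrix g id).det) * hsign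
  simp_rw [det_apply' (M.submatrix id _), Finset.sum_mul]
  rw [Finset.sum_comm]
  simp only [submatrix_apply, id_eq]
  rw [Finset.sum_congr rfl fun σ _ => hperm σ]
  simp [Fintype.card_perm]

theorem factorial_mul_det_mul_diagonal_mul_transpose [DecidableEq n] (M : Matrix m n R)
    (D : n → R) :
    ((Fintype.card m).factorial : R) * (M * diagonal D * Mᵀ).det =
      ∑ f : m → n, (∏ i, D (f i)) * (M.submatrix id f).det ^ 2 := by
  rw [factorial_mul_det_mul]
  refine Finset.sum_congr rfl fun f _ => ?_
  have hleft : (M * diagonal D).submatrix id f =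
      of fun i j => D (f j) * M.submatrix id f i j := by
    ext i j
    simp [mul_diagonal, mul_comm]
  rw [hleft, det_mul_row, ← transpose_submatrix, det_transpose]
  ring

end Matrix

theorem Antitone.prod_comp_le_prod_castLE {k n : ℕ} {a : Fin n → ℝ} (ha : Antitone a)
    (ha₀ : ∀ i, 0 ≤ a i) {g : Fin k → Fin n} (hg : Function.Injective g) (hkn : k ≤ n) :
    ∏ i, a (g i) ≤ ∏ i : Fin k, a (Fin.castLE hkn i) := by
  have hcard : (Finset.univ.image g).card = k := by
    rw [Finset.card_image_of_injective _ hg, Finset.card_fin]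
  let e := (Finset.univ.image g).orderEmbOfFin hcard
  have hprod : ∏ i, a (g i) = ∏ i, a (e i) := by
    have himage : Finset.univ.image g = Finset.univ.image e :=
      (Finset.image_orderEmbOfFin_univ _ hcard).symm
    rw [← Finset.prod_image (f := a) (hg.injOn), himage, Finset.prod_image e.injective.injOn]
  have hle : ∀ (j : ℕ) (hj : j < k), j ≤ (e ⟨j, hj⟩ : ℕ) := by
    intro j
    induction j with
    | zero => exact fun _ => Nat.zero_le _
    | succ j ih =>
      intro hj
      have hlt : e ⟨j, by omega⟩ < e ⟨j + 1, hj⟩ := e.strictMono (by simp [Fin.lt_def])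
      exact (ih (by omega)).trans_lt hlt
  rw [hprod]
  exact Finset.prod_le_prod (fun i _ => ha₀ _) fun i _ => ha (hle i i.2)

/-- If every product of `k` distinct ratios `|lam j| / √(kap j)` is at most `C`, then so is
`|det (U Λ Uᵀ)| / √(det (U K Uᵀ))` for every `U` with orthonormal rows. -/
theorem Matrix.abs_det_mul_diagonal_mul_transpose_le {m n : Type*} [Fintype m] [DecidableEq m]
    [Fintype n] [DecidableEq n] {U : Matrix m n ℝ} (hU : U * Uᵀ = 1) {lam kap : n → ℝ}
    (hkap : ∀ j, 0 < kap j) {C : ℝ} (hC : 0 ≤ C)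
    (hbound : ∀ f : m → n, Function.Injective f → ∏ i, |lam (f i) / √(kap (f i))| ≤ C) :
    0 < (U * diagonal kap * Uᵀ).det ∧
      |(U * diagonal lam * Uᵀ).det| ≤ C * √(U * diagonal kap * Uᵀ).det := by
  set w : (m → n) → ℝ := fun f => (U.submatrix id f).det ^ 2 / (Fintype.card m).factorial
  have hfac : (0 : ℝ) < (Fintype.card m).factorial := by positivity
  have hw (f) : 0 ≤ w f := by positivity
  have hdet (D : n → ℝ) : (U * diagonal D * Uᵀ).det = ∑ f : m → n, (∏ i, D (f i)) * w f := by
    rw [← mul_right_inj' hfac.ne', factorial_mul_det_mul_diagonal_mul_transpose, Finset.mul_sum]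
    refine Finset.sum_congr rfl fun f _ => ?_
    simp only [w]
    field_simp
  have hw_sum : ∑ f, w f = 1 := by
    have h := hdet fun _ => 1
    simpa [hU] using h.symm
  have hw_inj (f : m → n) (hf : ¬ Function.Injective f) : w f = 0 := by
    obtain ⟨i, j, hij, hne⟩ := Function.not_injective_iff.1 hf
    have hzero : (U.submatrix id f).det = 0 :=
      det_zero_of_column_eq hne fun l => by simp [hij]
    simp [w, hzero]
  have hkap_prod (f : m → n) : 0 < ∏ i, kap (f i) := Finset.prod_pos fun i _ => hkap _
  have hpos : 0 < (U * diagonal kap * Uᵀ).det := by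
    rw [hdet]
    refine (Finset.sum_nonneg fun f _ => mul_nonneg (hkap_prod f).le (hw f)).lt_of_ne' fun h => ?_
    rw [Finset.sum_eq_zero_iff_of_nonneg fun f _ => mul_nonneg (hkap_prod f).le (hw f)] at h
    have hw_zero : ∑ f, w f = 0 := Finset.sum_eq_zero fun f hf =>
      (mul_eq_zero.1 (h f hf)).resolve_left (hkap_prod f).ne'
    linarith
  refine ⟨hpos, ?_⟩
  have hterm (f : m → n) : |(∏ i, lam (f i)) * w f| ≤ C * (√(∏ i, kap (f i)) * w f) := by
    by_cases hf : Function.Injective f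
    · have hprod : |∏ i, lam (f i)| =
          (∏ i, |lam (f i) / √(kap (f i))|) * √(∏ i, kap (f i)) := by
        rw [Real.sqrt_prod _ fun i _ => (hkap _).le, ← Finset.prod_mul_distrib, Finset.abs_prod]
        refine Finset.prod_congr rfl fun i _ => ?_
        have hs := Real.sqrt_pos.2 (hkap (f i))
        rw [abs_div, abs_of_pos hs, div_mul_cancel₀ _ hs.ne']
      rw [abs_mul, abs_of_nonneg (hw f), hprod, ← mul_assoc]
      have := hw f
      gcongr
      exact hbound f hf
    · simp [hw_inj f hf]
  have hcauchy : ∑ f : m → n, √(∏ i, kap (f i)) * w f ≤ √(U * diagonal kap * Uᵀ).det := by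
    refine Real.le_sqrt_of_sq_le ?_
    rw [hdet]
    have h := Finset.sum_sq_le_sum_mul_sum_of_sq_le_mul Finset.univ (f := w)
      (g := fun f => (∏ i, kap (f i)) * w f) (r := fun f => √(∏ i, kap (f i)) * w f)
      (fun f _ => hw f) (fun f _ => mul_nonneg (hkap_prod f).le (hw f))
      (fun f _ => by rw [mul_pow, Real.sq_sqrt (hkap_prod f).le]; exact le_of_eq (by ring))
    rwa [hw_sum, one_mul] at h
  calc |(U * diagonal lam * Uᵀ).det| ≤ ∑ f : m → n, |(∏ i, lam (f i)) * w f| := by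
        rw [hdet]
        exact Finset.abs_sum_le_sum_abs _ _
    _ ≤ ∑ f : m → n, C * (√(∏ i, kap (f i)) * w f) := Finset.sum_le_sum fun f _ => hterm f
    _ ≤ C * √(U * diagonal kap * Uᵀ).det := by
        rw [← Finset.mul_sum]
        exact mul_le_mul_of_nonneg_left hcauchy hC

/-- let `A = V Λ Vᵀ` and `Σ = V K Vᵀ` share the orthogonal
eigenvector matrix `V`, with `Λ = diag(λ)` (all `λ_i ≠ 0`) and `K = diag(κ)`
(all `κ_i > 0`), and let `d̃₁, …, d̃_n` be the numbers `λ_i/√κ_i` rearranged so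
that `|d̃₁| ≥ … ≥ |d̃_n|`. Then for every `1 ≤ k ≤ n` and every `W ∈ ℝ^{k×n}`
with `W Wᵀ = I_k` (so `W† = Wᵀ`) and `det(W A Wᵀ) ≠ 0`, the causal emergence
satisfies `Δ𝒥(W) = ln(|det(WAWᵀ)|^{1/k}/|det A|^{1/n}) +
ln((det Σ)^{1/2n}/(det(WΣWᵀ))^{1/2k}) ≤ (1/k) Σ_{i≤k} ln|d̃_i| − (1/n) Σ_{i≤n} ln|d̃_i|`. -/
theorem stmt11 {n : ℕ} (hn : 1 ≤ n)
    (V : Matrix (Fin n) (Fin n) ℝ) (hV : V * Vᵀ = 1) (hV' : Vᵀ * V = 1)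
    (lam kap : Fin n → ℝ) (hlam : ∀ i, lam i ≠ 0) (hkap : ∀ i, 0 < kap i)
    (A Sg : Matrix (Fin n) (Fin n) ℝ)
    (hA : A = V * Matrix.diagonal lam * Vᵀ)
    (hSg : Sg = V * Matrix.diagonal kap * Vᵀ)
    (d : Fin n → ℝ)
    (hd : ∃ π : Equiv.Perm (Fin n), ∀ i, d i = lam (π i) / Real.sqrt (kap (π i)))
    (hdsort : ∀ i j : Fin n, i ≤ j → |d j| ≤ |d i|) :
    ∀ (k : ℕ), 1 ≤ k → k ≤ n →
      ∀ W : Matrix (Fin k) (Fin n) ℝ, W * Wᵀ = 1 → (W * A * Wᵀ).det ≠ 0 →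
        Real.log (|(W * A * Wᵀ).det| ^ ((1 : ℝ) / k) / |A.det| ^ ((1 : ℝ) / n)) +
          Real.log (Sg.det ^ (1 / (2 * (n : ℝ))) /
            (W * Sg * Wᵀ).det ^ (1 / (2 * (k : ℝ)))) ≤
        (1 / (k : ℝ)) * (∑ i ∈ Finset.univ.filter (fun i : Fin n => (i : ℕ) < k),
            Real.log |d i|) -
        (1 / (n : ℝ)) * (∑ i : Fin n, Real.log |d i|) := by
  intro k hk hkn W hW hWA
  obtain ⟨π, hπ⟩ := hd
  have hd_ne (i : Fin n) : 0 < |d i| := by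
    rw [abs_pos, hπ]
    exact div_ne_zero (hlam _) (Real.sqrt_pos.2 (hkap _)).ne'
  set C : ℝ := ∏ i : Fin k, |d (Fin.castLE hkn i)| with hC
  have hC_pos : 0 < C := Finset.prod_pos fun i _ => hd_ne _
  have hconj (D : Fin n → ℝ) :
      W * (V * diagonal D * Vᵀ) * Wᵀ = (W * V) * diagonal D * (W * V)ᵀ := by
    simp only [transpose_mul, Matrix.mul_assoc]
  have hU : (W * V) * (W * V)ᵀ = 1 := by
    rw [transpose_mul, Matrix.mul_assoc, ← Matrix.mul_assoc V, hV, Matrix.one_mul, hW]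
  have hbound (f : Fin k → Fin n) (hf : Function.Injective f) :
      ∏ i, |lam (f i) / √(kap (f i))| ≤ C := by
    have hsort : Antitone fun i => |d i| := fun i j hij => hdsort i j hij
    have h := hsort.prod_comp_le_prod_castLE (fun i => abs_nonneg (d i))
      (π.symm.injective.comp hf) hkn
    simpa [hπ, hC] using h
  obtain ⟨hdetK, hdetL⟩ :=
    Matrix.abs_det_mul_diagonal_mul_transpose_le hU (lam := lam) hkap hC_pos.le hbound
  rw [← hconj, ← hSg] at hdetK
  rw [← hconj, ← hconj, ← hSg, ← hA] at hdetL
  have hdet_conj (D : Fin n → ℝ) : (V * diagonal D * Vᵀ).det = ∏ i, D i := by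
    rw [det_mul_comm, ← Matrix.mul_assoc, hV', Matrix.one_mul, det_diagonal]
  have hdetA : A.det = ∏ i, lam i := by rw [hA, hdet_conj]
  have hdetS : Sg.det = ∏ i, kap i := by rw [hSg, hdet_conj]
  have hA_pos : 0 < |A.det| := by
    rw [hdetA, abs_pos]
    exact Finset.prod_ne_zero_iff.2 fun i _ => hlam i
  have hS_pos : 0 < Sg.det := by
    rw [hdetS]
    exact Finset.prod_pos fun i _ => hkap i
  have hWA_pos : 0 < |(W * A * Wᵀ).det| := abs_pos.2 hWA
  have hsum_all : ∑ i, Real.log |d i| = Real.log |A.det| - Real.log Sg.det / 2 := by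
    rw [hdetA, hdetS, Finset.abs_prod, Real.log_prod fun i _ => abs_ne_zero.2 (hlam i),
      Real.log_prod fun i _ => (hkap i).ne', Finset.sum_div, ← Finset.sum_sub_distrib,
      ← Equiv.sum_comp π fun i => Real.log |lam i| - Real.log (kap i) / 2]
    refine Finset.sum_congr rfl fun i _ => ?_
    have hs := Real.sqrt_pos.2 (hkap (π i))
    rw [hπ, abs_div, abs_of_pos hs, Real.log_div (abs_ne_zero.2 (hlam _)) hs.ne',
      Real.log_sqrt (hkap _).le]
  have hsum_top : ∑ i ∈ Finset.univ.filter (fun i : Fin n => (i : ℕ) < k), Real.log |d i| =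
      Real.log C := by
    have hfilter : Finset.univ.filter (fun i : Fin n => (i : ℕ) < k) =
        Finset.univ.image (Fin.castLE hkn) := by
      ext i
      simp only [Finset.mem_filter, Finset.mem_univ, true_and, Finset.mem_image]
      exact ⟨fun hi => ⟨⟨i, hi⟩, rfl⟩, by rintro ⟨j, rfl⟩; exact j.2⟩
    rw [hfilter, Finset.sum_image (Fin.castLE_injective hkn).injOn, hC,
      Real.log_prod fun i _ => (hd_ne _).ne']
  have hlog : Real.log |(W * A * Wᵀ).det| ≤ Real.log C + Real.log (W * Sg * Wᵀ).det / 2 := by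
    rw [← Real.log_sqrt hdetK.le, ← Real.log_mul hC_pos.ne' (Real.sqrt_pos.2 hdetK).ne']
    exact Real.log_le_log hWA_pos hdetL
  have hk_pos : (0 : ℝ) < 1 / k := by
    have : (0 : ℝ) < k := by exact_mod_cast hk
    positivity
  rw [hsum_all, hsum_top,
    Real.log_div (Real.rpow_pos_of_pos hWA_pos _).ne' (Real.rpow_pos_of_pos hA_pos _).ne',
    Real.log_div (Real.rpow_pos_of_pos hS_pos _).ne' (Real.rpow_pos_of_pos hdetK _).ne',
    Real.log_rpow hWA_pos, Real.log_rpow hA_pos, Real.log_rpow hS_pos, Real.log_rpow hdetK]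
  have hmul := mul_le_mul_of_nonneg_left hlog hk_pos.le
  have hhalf (x : ℝ) : 1 / (2 * x) = 1 / x / 2 := by rw [mul_comm, div_mul_eq_div_div]
  rw [hhalf, hhalf]
  linarith
end

section
/- Let Σ ∈ ℝ^{n×n} be symmetric positive definite, let Σ^{1/2} denote its unique symmetric positive definite square root and Σ^{−1/2} = (Σ^{1/2})⁻¹, and let W ∈ ℝ^{k×n} (1 ≤ k ≤ n) satisfy W Wᵀ = I_k. Then det(W Σ Wᵀ)^{−1/2} ≤ det(W Σ^{−1/2} Wᵀ). -/
open Matrix BigOperators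

namespace Matrix

variable {m : Type*} [Fintype m]

theorem PosSemidef.one_le_det_one_add [DecidableEq m] {M : Matrix m m ℝ} (hM : M.PosSemidef) :
    1 ≤ (1 + M).det := by
  have h := congrArg (Polynomial.eval (-1)) hM.isHermitian.charpoly_eq
  rw [eval_charpoly, Polynomial.eval_prod] at h
  have hneg : scalar m (-1 : ℝ) - M = -(1 + M) := by
    rw [map_neg, map_one]
    abel
  have hfactor : ∀ i, Polynomial.eval (-1)
      (Polynomial.X - Polynomial.C (hM.isHermitian.eigenvalues i : ℝ)) =
        (-1) * (1 + hM.isHermitian.eigenvalues i) := by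
    intro i
    simp
    ring
  have hdet : (1 + M).det = ∏ i, (1 + hM.isHermitian.eigenvalues i) := by
    rw [hneg, det_neg] at h
    simp only [RCLike.ofReal_real_eq_id, id_eq] at h
    rw [Finset.prod_congr rfl fun i _ => hfactor i, Finset.prod_mul_distrib, Finset.prod_const, Finset.card_univ] at h
    exact mul_left_cancel₀ (pow_ne_zero _ (by norm_num)) h
  rw [hdet]
  exact Finset.one_le_prod fun i _ => by linarith [hM.eigenvalues_nonneg i]

open scoped MatrixOrder in
theorem PosDef.det_le_det_of_sub_posSemidef [DecidableEq m] {P Q : Matrix m m ℝ} (hP : P.PosDef)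
    (hPQ : (Q - P).PosSemidef) : P.det ≤ Q.det := by
  obtain ⟨L, hL, rfl⟩ :=
    CStarAlgebra.isStrictlyPositive_iff_eq_star_mul_self.mp hP.isStrictlyPositive
  rw [star_eq_conjTranspose] at *
  have hdet : IsUnit L.det := (isUnit_iff_isUnit_det L).mp hL
  have hLt : Lᴴ * (L⁻¹)ᴴ = 1 := by
    rw [← conjTranspose_mul, nonsing_inv_mul _ hdet, conjTranspose_one]
  have hQ : Q = Lᴴ * (1 + (L⁻¹)ᴴ * (Q - Lᴴ * L) * L⁻¹) * L := by
    calc Q = Lᴴ * L + (Lᴴ * (L⁻¹)ᴴ) * (Q - Lᴴ * L) * (L⁻¹ * L) := by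
          rw [hLt, nonsing_inv_mul _ hdet]
          simp
      _ = _ := by
          simp only [Matrix.mul_add, Matrix.add_mul, Matrix.mul_assoc, Matrix.one_mul]
  have hone := (hPQ.conjTranspose_mul_mul_same L⁻¹).one_le_det_one_add
  have hnonneg := (posSemidef_conjTranspose_mul_self L).det_nonneg
  rw [hQ, det_mul (_ * _) L, det_mul Lᴴ (1 + _), mul_right_comm, ← det_mul]
  exact le_mul_of_one_le_right hnonneg hone

variable {l : Type*} [Fintype l] [DecidableEq l]

theorem PosDef.mul_mul_transpose_of_mul_transpose_eq_one {S : Matrix m m ℝ} (hS : S.PosDef)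
    {W : Matrix l m ℝ} (hW : W * Wᵀ = 1) : (W * S * Wᵀ).PosDef := by
  rw [← conjTranspose_eq_transpose_of_trivial]
  refine hS.mul_mul_conjTranspose_same fun x y hxy => ?_
  have h : (x ᵥ* W) ᵥ* Wᵀ = (y ᵥ* W) ᵥ* Wᵀ := congrArg (· ᵥ* Wᵀ) hxy
  simpa [vecMul_vecMul, hW] using h

/-- The compression of the square dominates the square of the compression. -/
theorem PosDef.posSemidef_compression_sq_sub {S : Matrix m m ℝ} (hS : S.PosDef)
    {W : Matrix l m ℝ} (hW : W * Wᵀ = 1) :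
    (W * (S * S) * Wᵀ - W * S * Wᵀ * (W * S * Wᵀ)).PosSemidef := by
  have hSt : Sᵀ = S := by simpa using hS.isHermitian.eq
  have h := posSemidef_self_mul_conjTranspose (W * S - W * S * Wᵀ * W)
  convert h using 1
  rw [conjTranspose_eq_transpose_of_trivial]
  simp only [transpose_sub, transpose_mul, transpose_transpose, hSt, Matrix.mul_sub,
    Matrix.sub_mul, Matrix.mul_assoc]
  rw [← Matrix.mul_assoc W Wᵀ, hW, Matrix.one_mul]
  abel

/-- The compression of the inverse dominates the inverse of the compression. -/
theorem PosDef.posSemidef_compression_inv_sub [DecidableEq m] {S : Matrix m m ℝ} (hS : S.PosDef)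
    {W : Matrix l m ℝ} (hW : W * Wᵀ = 1) :
    (W * S⁻¹ * Wᵀ - (W * S * Wᵀ)⁻¹).PosSemidef := by
  have hC := hS.mul_mul_transpose_of_mul_transpose_eq_one hW
  have hSt : Sᵀ = S := by simpa using hS.isHermitian.eq
  have hCt : (W * S * Wᵀ)ᵀ = W * S * Wᵀ := by simpa using hC.isHermitian.eq
  have hSu := (isUnit_iff_isUnit_det S).mp hS.isUnit
  have hCu := (isUnit_iff_isUnit_det _).mp hC.isUnit
  have h := hS.posSemidef.mul_mul_conjTranspose_same (W * S⁻¹ - (W * S * Wᵀ)⁻¹ * W)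
  have hCC := nonsing_inv_mul _ hCu
  convert h using 1
  rw [conjTranspose_eq_transpose_of_trivial, transpose_sub, transpose_mul, transpose_mul,
    transpose_nonsing_inv, transpose_nonsing_inv, hSt, hCt]
  generalize (W * S * Wᵀ)⁻¹ = D at hCC ⊢
  have hleft : (W * S⁻¹ - D * W) * S = W - D * W * S := by
    rw [Matrix.sub_mul, Matrix.mul_assoc W, nonsing_inv_mul _ hSu, Matrix.mul_one]
  have h₁ : D * W * S * (S⁻¹ * Wᵀ) = D := by
    rw [Matrix.mul_assoc (D * W), ← Matrix.mul_assoc S, mul_nonsing_inv _ hSu, Matrix.one_mul,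
      Matrix.mul_assoc, hW, Matrix.mul_one]
  have h₂ : W * (Wᵀ * D) = D := by rw [← Matrix.mul_assoc, hW, Matrix.one_mul]
  have h₃ : D * W * S * (Wᵀ * D) = D := by
    rw [← Matrix.mul_assoc, Matrix.mul_assoc D W S, Matrix.mul_assoc D, hCC, Matrix.one_mul]
  rw [hleft, Matrix.sub_mul, Matrix.mul_sub, Matrix.mul_sub, h₁, h₂, h₃, ← Matrix.mul_assoc]
  abel

end Matrix

/-- let `Σ` be symmetric positive definite, `S = Σ^{1/2}` its
unique symmetric positive definite square root (`S * S = Σ`), and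
`Σ^{−1/2} = S⁻¹`. Then for every `W ∈ ℝ^{k×n}` with orthonormal rows
(`W Wᵀ = I_k`, `1 ≤ k ≤ n`), `det(W Σ Wᵀ)^{−1/2} ≤ det(W Σ^{−1/2} Wᵀ)`. -/
theorem stmt12 {n k : ℕ} (hk : 1 ≤ k) (hkn : k ≤ n)
    (Sg : Matrix (Fin n) (Fin n) ℝ) (hSg : Sg.PosDef)
    (S : Matrix (Fin n) (Fin n) ℝ) (hS : S.PosDef) (hSsq : S * S = Sg)
    (W : Matrix (Fin k) (Fin n) ℝ) (hW : W * Wᵀ = 1) :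
    (W * Sg * Wᵀ).det ^ (-(1 : ℝ) / 2) ≤ (W * S⁻¹ * Wᵀ).det := by
  subst hSsq
  have hC := hS.mul_mul_transpose_of_mul_transpose_eq_one hW
  have hCdet := hC.det_pos
  have hCC : (W * S * Wᵀ * (W * S * Wᵀ)).PosDef := by
    have h := PosDef.conjTranspose_mul_self (W * S * Wᵀ)
      (mulVec_injective_iff_isUnit.mpr hC.isUnit)
    rwa [hC.isHermitian.eq] at h
  have hsq := hCC.det_le_det_of_sub_posSemidef (hS.posSemidef_compression_sq_sub hW)
  have hinv := hC.inv.det_le_det_of_sub_posSemidef (hS.posSemidef_compression_inv_sub hW)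
  rw [det_mul] at hsq
  rw [det_nonsing_inv, Ring.inverse_eq_inv'] at hinv
  refine le_trans ?_ hinv
  calc (W * (S * S) * Wᵀ).det ^ (-(1 : ℝ) / 2)
      ≤ ((W * S * Wᵀ).det * (W * S * Wᵀ).det) ^ (-(1 : ℝ) / 2) :=
        Real.rpow_le_rpow_of_nonpos (mul_pos hCdet hCdet) hsq (by norm_num)
    _ = ((W * S * Wᵀ).det)⁻¹ := by
        rw [← sq, ← Real.rpow_natCast, ← Real.rpow_mul hCdet.le, ← Real.rpow_neg_one]
        norm_num
end

section
/- Let A = V Λ Vᵀ ∈ ℝ^{n×n} where V ∈ ℝ^{n×n} is orthogonal and Λ = diag(λ₁, …, λ_n) with |λ₁| ≥ … ≥ |λ_n|. Let W̃_k ∈ ℝ^{k×k} be invertible (1 ≤ k ≤ n) and set W = (W̃_k | 0_{k×(n−k)}) Vᵀ. Then ‖A − W† W A W† W‖_F = √(Σ_{l=k+1}^{n} λ_l²); hence such W simultaneously attains the lower bound of the Frobenius reconstruction error and the upper bound ∏_{i=1}^{k}|λ_i| of |det(W A W†)|, so the minimizers of the dynamical-loss supremum coincide with the maximizers of the degeneracy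 emergence. -/
open Matrix BigOperators

/-- Frobenius norm of a real matrix. -/
noncomputable def fnorm {m n : ℕ} (M : Matrix (Fin m) (Fin n) ℝ) : ℝ :=
  Real.sqrt (∑ i, ∑ j, M i j ^ 2)

/-- The `k×n` block matrix `(M | 0_{k×(n−k)})`. -/
def blockRow {k n : ℕ} (M : Matrix (Fin k) (Fin k) ℝ) : Matrix (Fin k) (Fin n) ℝ :=
  Matrix.of fun i j => if h : (j : ℕ) < k then M i ⟨j, h⟩ else 0

/-- Compressing a diagonal matrix by `(1 | 0)` keeps its first `k` diagonal entries. -/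
theorem blockRow_one_mul_diagonal_mul_transpose {n k : ℕ} (hkn : k ≤ n) (lam : Fin n → ℝ) :
    (blockRow 1 : Matrix (Fin k) (Fin n) ℝ) * Matrix.diagonal lam *
      (blockRow 1 : Matrix (Fin k) (Fin n) ℝ)ᵀ =
      Matrix.diagonal fun i => lam (Fin.castLE hkn i) := by
  have hE : (blockRow 1 : Matrix (Fin k) (Fin n) ℝ) =
      (1 : Matrix (Fin n) (Fin n) ℝ).submatrix (Fin.castLE hkn) id := by
    ext i j
    simp only [blockRow, Matrix.of_apply, Matrix.submatrix_apply, Matrix.one_apply, Fin.ext_iff,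
      Fin.val_castLE, id]
    grind
  ext i j
  simp only [hE, Matrix.mul_apply, Matrix.diagonal_apply]
  by_cases hij : i = j <;> simp [hij, Matrix.one_apply]

theorem blockRow_one_mul_transpose {n k : ℕ} (hkn : k ≤ n) :
    (blockRow 1 : Matrix (Fin k) (Fin n) ℝ) * (blockRow 1 : Matrix (Fin k) (Fin n) ℝ)ᵀ = 1 := by
  simpa using blockRow_one_mul_diagonal_mul_transpose hkn (fun _ => (1 : ℝ))

theorem transpose_mul_blockRow_one {n k : ℕ} :
    (blockRow 1 : Matrix (Fin k) (Fin n) ℝ)ᵀ * (blockRow 1 : Matrix (Fin k) (Fin n) ℝ) =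
      Matrix.diagonal fun i : Fin n => if (i : ℕ) < k then 1 else 0 := by
  ext i j
  simp only [Matrix.mul_apply, Matrix.transpose_apply, blockRow, Matrix.of_apply,
    Matrix.one_apply, Matrix.diagonal_apply]
  by_cases hi : (i : ℕ) < k
  · by_cases hj : (j : ℕ) < k
    · simp [hi, hj, Fin.ext_iff (n := n), eq_comm]
    · have hij : i ≠ j := by grind
      simp [hi, hj, hij]
  · simp [hi]

theorem blockRow_eq_mul {n k : ℕ} (M : Matrix (Fin k) (Fin k) ℝ) :
    (blockRow M : Matrix (Fin k) (Fin n) ℝ) = M * (blockRow 1 : Matrix (Fin k) (Fin n) ℝ) := by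
  ext i j
  simp only [Matrix.mul_apply, blockRow, Matrix.of_apply, Matrix.one_apply]
  by_cases hj : (j : ℕ) < k <;> simp [hj]

theorem fnorm_eq_sqrt_trace {m n : ℕ} (M : Matrix (Fin m) (Fin n) ℝ) :
    fnorm M = Real.sqrt (M * Mᵀ).trace := by
  simp [fnorm, Matrix.trace, Matrix.mul_apply, sq]

/-- The Frobenius norm is invariant under orthogonal conjugation. -/
theorem fnorm_conj {n : ℕ} {V : Matrix (Fin n) (Fin n) ℝ} (hV : Vᵀ * V = 1)
    (M : Matrix (Fin n) (Fin n) ℝ) : fnorm (V * M * Vᵀ) = fnorm M := by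
  have h : V * M * Vᵀ * (V * M * Vᵀ)ᵀ = V * (M * (Vᵀ * V) * Mᵀ * Vᵀ) := by
    simp only [Matrix.transpose_mul, Matrix.transpose_transpose, Matrix.mul_assoc]
  rw [fnorm_eq_sqrt_trace, fnorm_eq_sqrt_trace, h, Matrix.trace_mul_comm, hV, Matrix.mul_one,
    Matrix.mul_assoc, hV, Matrix.mul_one]

theorem fnorm_diagonal {n : ℕ} (d : Fin n → ℝ) :
    fnorm (Matrix.diagonal d) = Real.sqrt (∑ i, d i ^ 2) := by
  simp [fnorm_eq_sqrt_trace, Matrix.diagonal_mul_diagonal, Matrix.trace_diagonal, sq]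

/-- For `U` with orthonormal rows and `M` invertible, the pseudoinverse of `M U` is `Uᵀ M⁻¹`. -/
theorem transpose_mul_gram_inv {n k : ℕ} {M : Matrix (Fin k) (Fin k) ℝ} (hM : IsUnit M)
    {U : Matrix (Fin k) (Fin n) ℝ} (hU : U * Uᵀ = 1) :
    (M * U)ᵀ * ((M * U) * (M * U)ᵀ)⁻¹ = Uᵀ * M⁻¹ := by
  have hdet : IsUnit Mᵀ.det := by
    rw [Matrix.det_transpose]; exact (Matrix.isUnit_iff_isUnit_det M).mp hM
  have h : (M * U) * (M * U)ᵀ = M * Mᵀ := by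
    rw [Matrix.transpose_mul, Matrix.mul_assoc, ← Matrix.mul_assoc U, hU, Matrix.one_mul]
  rw [h, Matrix.mul_inv_rev, Matrix.transpose_mul, Matrix.mul_assoc,
    Matrix.mul_nonsing_inv_cancel_left _ _ hdet]

/-- for `A = V Λ Vᵀ` (`V` orthogonal, `|λ₁| ≥ … ≥ |λ_n|`),
invertible `W̃_k ∈ ℝ^{k×k}`, and `W = (W̃_k | 0) Vᵀ` (with `W† = Wᵀ(WWᵀ)⁻¹`),
the Frobenius reconstruction error attains its lower bound
`‖A − W†WAW†W‖_F = √(Σ_{l=k+1}^{n} λ_l²)`, and simultaneously `|det(W A W†)|`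
attains its upper bound `∏_{i=1}^{k}|λ_i|`; hence the minimizers of the
dynamical-loss supremum coincide with the maximizers of the degeneracy
emergence. -/
theorem stmt15 {n k : ℕ} (hk : 1 ≤ k) (hkn : k ≤ n)
    (V : Matrix (Fin n) (Fin n) ℝ) (hV : V * Vᵀ = 1) (hV' : Vᵀ * V = 1)
    (lam : Fin n → ℝ)
    (hsort : ∀ i j : Fin n, i ≤ j → |lam j| ≤ |lam i|)
    (A : Matrix (Fin n) (Fin n) ℝ) (hA : A = V * Matrix.diagonal lam * Vᵀ)
    (Wk : Matrix (Fin k) (Fin k) ℝ) (hWk : IsUnit Wk)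
    (W : Matrix (Fin k) (Fin n) ℝ) (hW : W = blockRow Wk * Vᵀ) :
    fnorm (A - (Wᵀ * (W * Wᵀ)⁻¹ * W) * A * (Wᵀ * (W * Wᵀ)⁻¹ * W)) =
      Real.sqrt (∑ i ∈ Finset.univ.filter (fun i : Fin n => k ≤ (i : ℕ)), lam i ^ 2) ∧
    |(W * A * (Wᵀ * (W * Wᵀ)⁻¹)).det| =
      ∏ i ∈ Finset.univ.filter (fun i : Fin n => (i : ℕ) < k), |lam i| := by
  have hdet : IsUnit Wk.det := (Matrix.isUnit_iff_isUnit_det Wk).mp hWk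
  set E : Matrix (Fin k) (Fin n) ℝ := blockRow 1 with hE
  have hW' : W = Wk * (E * Vᵀ) := by
    have h : W = (blockRow Wk : Matrix (Fin k) (Fin n) ℝ) * Vᵀ := hW
    rw [h, blockRow_eq_mul, Matrix.mul_assoc]
  have hU : E * Vᵀ * (E * Vᵀ)ᵀ = 1 := by
    rw [Matrix.transpose_mul, Matrix.transpose_transpose, Matrix.mul_assoc, ← Matrix.mul_assoc Vᵀ,
      hV', Matrix.one_mul, blockRow_one_mul_transpose hkn]
  have hpinv : Wᵀ * (W * Wᵀ)⁻¹ = V * Eᵀ * Wk⁻¹ := by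
    rw [hW', transpose_mul_gram_inv hWk hU, Matrix.transpose_mul, Matrix.transpose_transpose]
  have hproj : V * Eᵀ * Wk⁻¹ * W = V * (Eᵀ * E) * Vᵀ := by
    rw [hW', Matrix.mul_assoc _ Wk⁻¹, Matrix.nonsing_inv_mul_cancel_left _ _ hdet]
    simp only [Matrix.mul_assoc]
  have hcancel (X : Matrix (Fin n) (Fin n) ℝ) : Vᵀ * (V * X) = X := by
    rw [← Matrix.mul_assoc, hV', Matrix.one_mul]
  rw [hpinv, hproj]
  constructor
  · have hres : A - V * (Eᵀ * E) * Vᵀ * A * (V * (Eᵀ * E) * Vᵀ) =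
        V * (Matrix.diagonal lam - (Eᵀ * E) * Matrix.diagonal lam * (Eᵀ * E)) * Vᵀ := by
      rw [hA, Matrix.mul_sub, Matrix.sub_mul]
      generalize Eᵀ * E = D
      simp only [Matrix.mul_assoc, hcancel]
    rw [hres, fnorm_conj hV', hE, transpose_mul_blockRow_one, Matrix.diagonal_mul_diagonal,
      Matrix.diagonal_mul_diagonal, Matrix.diagonal_sub, fnorm_diagonal, Finset.sum_filter]
    congr 1
    refine Finset.sum_congr rfl fun i _ => ?_
    by_cases hi : (i : ℕ) < k
    · simp [hi, Nat.not_le.mpr hi]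
    · simp [hi, Nat.not_lt.mp hi]
  · have hcomp : W * A * (V * Eᵀ * Wk⁻¹) =
        Wk * (E * Matrix.diagonal lam * Eᵀ) * Wk⁻¹ := by
      have hcancel' (X : Matrix (Fin n) (Fin k) ℝ) : Vᵀ * (V * X) = X := by
        rw [← Matrix.mul_assoc, hV', Matrix.one_mul]
      rw [hW', hA]
      simp only [Matrix.mul_assoc, hcancel']
    rw [hcomp, Matrix.det_conj hWk, hE, blockRow_one_mul_diagonal_mul_transpose hkn,
      Matrix.det_diagonal, Finset.abs_prod]
    refine Finset.prod_bij (fun i _ => Fin.castLE hkn i) ?_ ?_ ?_ ?_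
    · intro i _
      simp
    · intro i _ j _ h
      exact Fin.castLE_injective hkn h
    · intro j hj
      exact ⟨⟨j, (Finset.mem_filter.mp hj).2⟩, Finset.mem_univ _, rfl⟩
    · intro i _
      rfl
end
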